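/- arXiv:math/0210065 — 4 statements merged into one kernel-verified Lean document; each statement's English description precedes it below -/
import Mathlib

section
/- Let I ⊂ K[x_1,…,x_n] be a polymatroidal monomial ideal. Then I has linear quotients with respect to its minimal monomial generators listed in decreasing reverse lexicographical order: for each u ∈ G(I), letting J be the ideal generated by all v ∈ G(I) with v > u in the reverse lexicographical order, the colon ideal J : u is generated by variables. -/
open MvPolynomial

/-- `u <_revlex v` (reverse lexicographic comparison of monomials of the same degree,
via their exponent vectors): at the last index where they differ, `u` has the
larger exponent. -/
def RevLexLt {n : ℕ} (u v : Fin n →₀ ℕ) : Prop :=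
  ∃ i : Fin n, v i < u i ∧ ∀ k : Fin n, i < k → u k = v k

/-- Replacing `x_i` by a variable `x_j` with `j < i` moves a monomial up in revlex. -/
theorem revLexLt_exchange {n : ℕ} {u : Fin n →₀ ℕ} {i j : Fin n} (hji : j < i) (hu : 0 < u i) :
    RevLexLt u (u - Finsupp.single i 1 + Finsupp.single j 1) := by
  refine ⟨i, ?_, fun k hk => ?_⟩
  · simp only [Finsupp.add_apply, Finsupp.tsub_apply, Finsupp.single_eq_same,
      Finsupp.single_eq_of_ne hji.ne']
    omega
  · simp [Finsupp.single_eq_of_ne hk.ne', Finsupp.single_eq_of_ne (hji.trans hk).ne']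

theorem exchange_le_add_single {n : ℕ} (u : Fin n →₀ ℕ) (i j : Fin n) :
    u - Finsupp.single i 1 + Finsupp.single j 1 ≤ u + Finsupp.single j 1 :=
  add_le_add_left tsub_le_self _

/-- If the exponent vectors above a monomial `u` satisfy the exchange condition `h`,
then the colon of the corresponding monomial ideal by `u` is generated by variables. -/
theorem colon_span_monomial_eq_span_X {σ K : Type*} [Field K] (A : Set (σ →₀ ℕ)) (u : σ →₀ ℕ)
    (h : ∀ v ∈ A, ∃ j, u j < v j ∧ ∃ w ∈ A, w ≤ u + Finsupp.single j 1) :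
    (Ideal.span ((fun v => monomial v (1 : K)) '' A)).colon (Ideal.span {monomial u (1 : K)}) =
      Ideal.span (X '' {j | ∃ w ∈ A, w ≤ u + Finsupp.single j 1}) := by
  apply le_antisymm
  · intro f hf
    have hfu : f * monomial u 1 ∈ Ideal.span ((fun v => monomial v (1 : K)) '' A) :=
      Submodule.mem_colon.1 hf _ (Ideal.mem_span_singleton_self _)
    rw [mem_ideal_span_monomial_image] at hfu
    rw [mem_ideal_span_X_image]
    intro m hm
    obtain ⟨v, hv, hle⟩ := hfu (m + u) (by
      rwa [mem_support_iff, coeff_mul_monomial, mul_one, ← mem_support_iff])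
    obtain ⟨j, hj, hw⟩ := h v hv
    refine ⟨j, hw, ?_⟩
    have := hle j
    rw [Finsupp.add_apply] at this
    omega
  · rw [Ideal.span_le]
    rintro _ ⟨j, ⟨w, hw, hle⟩, rfl⟩
    rw [SetLike.mem_coe, Submodule.mem_colon]
    intro p hp
    obtain ⟨q, rfl⟩ := Ideal.mem_span_singleton'.1 hp
    rw [smul_eq_mul, mul_left_comm]
    apply Ideal.mul_mem_left
    rw [mem_ideal_span_monomial_image]
    intro m hm
    rw [X, monomial_mul, mul_one] at hm
    rw [Finset.mem_singleton.1 (support_monomial_subset hm), add_comm]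
    exact ⟨w, hw, hle⟩

/-- **Proposition 5.2**: a polymatroidal monomial ideal `I` has linear quotients with
respect to the reverse lexicographic order on its minimal monomial generators `G(I)`:
for each `u ∈ G(I)`, if `J` is the ideal generated by all `v ∈ G(I)` with `v > u` in
revlex, then `J : u` is generated by variables. -/
theorem statement_14 (K : Type) [Field K] (n : ℕ)
    (I : Ideal (MvPolynomial (Fin n) K)) (G : Finset (Fin n →₀ ℕ)) (δ : ℕ)
    (hdeg : ∀ u ∈ G, (u.sum fun _ e => e) = δ)
    (hgen : I = Ideal.span ((fun u => monomial u (1 : K)) '' G))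
    (hmin : ∀ u ∈ G, monomial u (1 : K) ∉
        Ideal.span ((fun v => monomial v (1 : K)) '' ((G : Set (Fin n →₀ ℕ)) \ {u})))
    (hpoly : ∀ u ∈ G, ∀ v ∈ G, ∀ i : Fin n, v i < u i →
        ∃ j : Fin n, u j < v j ∧ u - Finsupp.single i 1 + Finsupp.single j 1 ∈ G) :
    ∀ u ∈ G, ∃ S ⊆ Set.range (X : Fin n → MvPolynomial (Fin n) K),
      (Ideal.span ((fun v => monomial v (1 : K)) ''
          {v : Fin n →₀ ℕ | v ∈ G ∧ RevLexLt u v})).colon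
        (Ideal.span {monomial u (1 : K)}) = Ideal.span S := by
  intro u hu
  refine ⟨_, Set.image_subset_range _ _, colon_span_monomial_eq_span_X _ u ?_⟩
  rintro v ⟨hv, i, hi, hk⟩
  obtain ⟨j, hj, hw⟩ := hpoly u hu v hv i hi
  have hji : j < i := by
    rcases lt_trichotomy j i with h | rfl | h
    · exact h
    · exact absurd hi hj.asymm
    · exact absurd (hk j h) hj.ne
  exact ⟨j, hj, _, ⟨hw, revLexLt_exchange hji (pos_of_gt hi)⟩, exchange_le_add_single u i j⟩
end

section
/- Let I and J be polymatroidal monomial ideals in K[x_1,…,x_n]. Then the product IJ is polymatroidal. -/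
open MvPolynomial

/-- A monomial ideal `I ⊆ K[x_1,…,x_n]` is *polymatroidal* if its minimal monomial
generators `G(I)` all have the same degree and satisfy the exchange property: for
all `u, v ∈ G(I)` and all `i` with `ν_i(u) > ν_i(v)` there is `j` with
`ν_j(v) > ν_j(u)` such that `x_j (u / x_i) ∈ G(I)`. -/
def IsPolymatroidal {K : Type} [Field K] {n : ℕ}
    (I : Ideal (MvPolynomial (Fin n) K)) : Prop :=
  ∃ (G : Finset (Fin n →₀ ℕ)) (δ : ℕ),
    (∀ u ∈ G, (u.sum fun _ e => e) = δ) ∧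
    I = Ideal.span ((fun u => monomial u (1 : K)) '' G) ∧
    (∀ u ∈ G, monomial u (1 : K) ∉
        Ideal.span ((fun v => monomial v (1 : K)) '' ((G : Set (Fin n →₀ ℕ)) \ {u}))) ∧
    (∀ u ∈ G, ∀ v ∈ G, ∀ i : Fin n, v i < u i →
        ∃ j : Fin n, u j < v j ∧ u - Finsupp.single i 1 + Finsupp.single j 1 ∈ G)

/-- The exchange property of the set of exponent vectors of a polymatroidal ideal. -/
def HasExchange {σ : Type*} (A : Set (σ →₀ ℕ)) : Prop :=
  ∀ u ∈ A, ∀ v ∈ A, ∀ i, v i < u i →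
    ∃ j, u j < v j ∧ u - Finsupp.single i 1 + Finsupp.single j 1 ∈ A

lemma tsub_single_add_single_add {σ : Type*} {a : σ →₀ ℕ} {k : σ} (j : σ) (h : 0 < a k) :
    a - Finsupp.single k 1 + Finsupp.single j 1 + Finsupp.single k 1 =
      a + Finsupp.single j 1 := by
  rw [add_right_comm, tsub_add_cancel_of_le (by simpa using Nat.succ_le_of_lt h)]

/-- An exchange step from `a` towards `c` decreases the positive part of `a - c`. -/
lemma degree_exchange_tsub_lt {σ : Type*} {a c : σ →₀ ℕ} {k j : σ}
    (hk : c k < a k) (hj : a j < c j) :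
    (a - Finsupp.single k 1 + Finsupp.single j 1 - c).degree < (a - c).degree := by
  classical
  have h : a - Finsupp.single k 1 + Finsupp.single j 1 - c + Finsupp.single k 1 = a - c := by
    ext l
    simp only [Finsupp.add_apply, Finsupp.tsub_apply, Finsupp.single_apply]
    split_ifs <;> subst_vars <;> omega
  rw [← h, map_add, Finsupp.degree_single]
  exact Nat.lt_succ_self _

/-- Repeatedly exchanging in one of the two summands, starting from any pair `a`, `b` whose sum is
`u - e_i + e_k`, terminates at an index where `u` is smaller than `c + d`. -/
lemma exists_exchange_add {σ : Type*} {A B : Set (σ →₀ ℕ)}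
    (hA : HasExchange A) (hB : HasExchange B) {c d u : σ →₀ ℕ} (hc : c ∈ A) (hd : d ∈ B)
    {i : σ} (hi : (c + d) i < u i) (a b : σ →₀ ℕ) (ha : a ∈ A) (hb : b ∈ B) (k : σ)
    (hk : a + b + Finsupp.single i 1 = u + Finsupp.single k 1) :
    ∃ j, u j < (c + d) j ∧ ∃ a' ∈ A, ∃ b' ∈ B,
      a' + b' + Finsupp.single i 1 = u + Finsupp.single j 1 := by
  classical
  by_cases huk : u k < (c + d) k
  · exact ⟨k, huk, a, ha, b, hb, hk⟩
  have hlt : c k < a k ∨ d k < b k := by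
    have := DFunLike.congr_fun hk k
    simp only [Finsupp.add_apply, Finsupp.single_apply] at this huk hi
    split_ifs at this <;> subst_vars <;> omega
  rcases hlt with h | h
  · obtain ⟨j, hj, hmem⟩ := hA a ha c hc k h
    have hdec := degree_exchange_tsub_lt h hj
    refine exists_exchange_add hA hB hc hd hi _ b hmem hb j ?_
    have h1 := tsub_single_add_single_add j (Nat.zero_lt_of_lt h)
    apply add_right_cancel (b := Finsupp.single k 1)
    calc _ = (a - Finsupp.single k 1 + Finsupp.single j 1 + Finsupp.single k 1) + b
          + Finsupp.single i 1 := by ac_rfl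
      _ = a + b + Finsupp.single i 1 + Finsupp.single j 1 := by rw [h1]; ac_rfl
      _ = _ := by rw [hk, add_right_comm]
  · obtain ⟨j, hj, hmem⟩ := hB b hb d hd k h
    have hdec := degree_exchange_tsub_lt h hj
    refine exists_exchange_add hA hB hc hd hi a _ ha hmem j ?_
    have h1 := tsub_single_add_single_add j (Nat.zero_lt_of_lt h)
    apply add_right_cancel (b := Finsupp.single k 1)
    calc _ = a + (b - Finsupp.single k 1 + Finsupp.single j 1 + Finsupp.single k 1)
          + Finsupp.single i 1 := by ac_rfl
      _ = a + b + Finsupp.single i 1 + Finsupp.single j 1 := by rw [h1]; ac_rfl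
      _ = _ := by rw [hk, add_right_comm]
termination_by (a - c).degree + (b - d).degree

open scoped Pointwise in
lemma HasExchange.add {σ : Type*} {A B : Set (σ →₀ ℕ)}
    (hA : HasExchange A) (hB : HasExchange B) : HasExchange (A + B) := by
  rintro _ ⟨a, ha, b, hb, rfl⟩ _ ⟨c, hc, d, hd, rfl⟩ i hi
  obtain ⟨j, hj, a', ha', b', hb', h⟩ :=
    exists_exchange_add hA hB hc hd hi a b ha hb i rfl
  refine ⟨j, hj, a', ha', b', hb', ?_⟩
  apply add_right_cancel (b := Finsupp.single i 1)
  exact h.trans (tsub_single_add_single_add j (Nat.zero_lt_of_lt hi)).symm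

/-- Distinct monomials of the same degree generate minimally. -/
lemma monomial_notMem_span_of_degree_eq {σ R : Type*} [CommSemiring R] [Nontrivial R]
    {S : Set (σ →₀ ℕ)} {δ : ℕ} (hS : ∀ u ∈ S, u.degree = δ) {u : σ →₀ ℕ} (hu : u ∈ S) :
    monomial u (1 : R) ∉ Ideal.span ((fun v => monomial v (1 : R)) '' (S \ {u})) := by
  classical
  rw [mem_ideal_span_monomial_image]
  intro h
  obtain ⟨v, ⟨hv, hvu⟩, hle⟩ := h u (by simp [mem_support_iff])
  obtain ⟨w, rfl⟩ := exists_add_of_le hle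
  have h1 := hS _ hu
  rw [map_add, hS v hv] at h1
  have hw : w = 0 := (Finsupp.degree_eq_zero_iff w).1 (by omega)
  exact hvu (by simp [hw])

open scoped Pointwise in
lemma span_monomial_mul_span_monomial {σ R : Type*} [CommSemiring R] (A B : Set (σ →₀ ℕ)) :
    Ideal.span ((fun u => monomial u (1 : R)) '' A) *
        Ideal.span ((fun u => monomial u (1 : R)) '' B) =
      Ideal.span ((fun u => monomial u (1 : R)) '' (A + B)) := by
  rw [Ideal.span_mul_span']
  congr 1
  exact (Set.image_image2_distrib (fun a b => by simp [monomial_mul])).symm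

open scoped Pointwise in
theorem IsPolymatroidal.mul {K : Type} [Field K] {n : ℕ} {I J : Ideal (MvPolynomial (Fin n) K)}
    (hI : IsPolymatroidal I) (hJ : IsPolymatroidal J) : IsPolymatroidal (I * J) := by
  obtain ⟨A, α, hAdeg, rfl, -, hA⟩ := hI
  obtain ⟨B, β, hBdeg, rfl, -, hB⟩ := hJ
  have hdeg : ∀ u ∈ A + B, u.degree = α + β := by
    intro u hu
    obtain ⟨a, ha, b, hb, rfl⟩ := Finset.mem_add.1 hu
    rw [map_add, ← hAdeg a ha, ← hBdeg b hb]
    rfl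
  refine ⟨A + B, α + β, fun u hu => (Finsupp.degree_apply u).symm.trans (hdeg u hu), ?_, ?_, ?_⟩
  · rw [Finset.coe_add, span_monomial_mul_span_monomial]
  · exact fun u hu => monomial_notMem_span_of_degree_eq hdeg (Finset.mem_coe.2 hu)
  · have h := HasExchange.add (A := (A : Set (Fin n →₀ ℕ))) (B := (B : Set (Fin n →₀ ℕ))) hA hB
    rw [← Finset.coe_add] at h
    exact h

/-- **Theorem 5.3**: the product of two polymatroidal monomial ideals is
polymatroidal. -/
theorem statement_15 (K : Type) [Field K] (n : ℕ)
    (I J : Ideal (MvPolynomial (Fin n) K))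
    (hI : IsPolymatroidal I) (hJ : IsPolymatroidal J) :
    IsPolymatroidal (I * J) :=
  hI.mul hJ
end

section
/- Let I_1, …, I_d be ideals of K[x_1,…,x_n], each generated by a subset of the variables {x_1,…,x_n}. Then the product I = I_1 ⋯ I_d has linear quotients. -/
open MvPolynomial

/-- An ideal `I ⊆ K[x_1,…,x_n]` has *linear quotients* if it admits a minimal system
of homogeneous generators `m_1, …, m_k` such that each colon ideal
`(m_1, …, m_{t-1}) : m_t` is generated by linear forms. -/
def HasLinearQuotients {K : Type} [Field K] {n : ℕ}
    (I : Ideal (MvPolynomial (Fin n) K)) : Prop :=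
  ∃ (k : ℕ) (m : Fin k → MvPolynomial (Fin n) K) (dg : Fin k → ℕ),
    (∀ t, (m t).IsHomogeneous (dg t)) ∧ (∀ t, m t ≠ 0) ∧
    Ideal.span (Set.range m) = I ∧
    (∀ t, m t ∉ Ideal.span (m '' {t' | t' ≠ t})) ∧
    ∀ t : Fin k, ∃ L : Set (MvPolynomial (Fin n) K), (∀ f ∈ L, f.IsHomogeneous 1) ∧
      (Ideal.span (m '' {t' | t' < t})).colon (Ideal.span {m t}) = Ideal.span L

/-- The number of times each point is attained by `f`, that is, the exponent vector of the
monomial `∏ t, X (f t)`. -/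
noncomputable def fiberCount {ι σ : Type*} [Fintype ι] (f : ι → σ) : σ →₀ ℕ :=
  ∑ t, Finsupp.single (f t) 1

lemma fiberCount_update {ι σ : Type*} [Fintype ι] [DecidableEq ι] (g : ι → σ) (t : ι) (k : σ) :
    fiberCount (Function.update g t k) + Finsupp.single (g t) 1 =
      fiberCount g + Finsupp.single k 1 := by
  simp only [fiberCount]
  rw [← Finset.add_sum_erase _ _ (Finset.mem_univ t),
    ← Finset.add_sum_erase _ (fun s => Finsupp.single (g s) 1) (Finset.mem_univ t)]
  have : ∑ s ∈ Finset.univ.erase t, Finsupp.single (Function.update g t k s) 1 =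
      ∑ s ∈ Finset.univ.erase t, Finsupp.single (g s) 1 :=
    Finset.sum_congr rfl fun s hs => by
      rw [Function.update_of_ne (Finset.ne_of_mem_erase hs)]
  rw [this, Function.update_self]
  abel

lemma fiberCount_apply {ι σ : Type*} [Fintype ι] [DecidableEq σ] (f : ι → σ) (j : σ) :
    fiberCount f j = (Finset.univ.filter fun t => f t = j).card := by
  simp [fiberCount, Finsupp.finsetSum_apply, Finsupp.single_apply]

/-- The exchange property of transversal polymatroids. -/
lemma exists_fiberCount_exchange {ι σ : Type*} [Fintype ι] (S : ι → Finset σ)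
    {f g : ι → σ} (hf : ∀ t, f t ∈ S t) (hg : ∀ t, g t ∈ S t) {j : σ}
    (hj : fiberCount f j < fiberCount g j) :
    ∃ (i : σ) (h : ι → σ), (∀ t, h t ∈ S t) ∧ fiberCount g i < fiberCount f i ∧
      fiberCount h + Finsupp.single j 1 = fiberCount g + Finsupp.single i 1 := by
  classical
  induction hN : (Finset.univ.filter fun t => f t ≠ g t).card using Nat.strong_induction_on
    generalizing g j with
  | _ N ih =>
  obtain ⟨t, ht, hft⟩ : ∃ t, g t = j ∧ f t ≠ j := by
    by_contra! H
    rw [fiberCount_apply, fiberCount_apply] at hj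
    exact hj.not_ge (Finset.card_le_card fun t ht => by simpa using H t (by simpa using ht))
  have hup := fiberCount_update g t (f t)
  rw [ht] at hup
  have hgS : ∀ s, Function.update g t (f t) s ∈ S s := fun s => by
    obtain rfl | hs := eq_or_ne s t
    · simpa using hf s
    · simpa [Function.update_of_ne hs] using hg s
  by_cases hk : fiberCount g (f t) < fiberCount f (f t)
  · exact ⟨f t, _, hgS, hk, hup⟩
  have hupk := DFunLike.congr_fun hup (f t)
  simp only [Finsupp.add_apply, Finsupp.single_eq_same, Finsupp.single_eq_of_ne hft] at hupk
  obtain ⟨i, h, hh, hi, hsum⟩ := ih _ (by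
    rw [← hN]
    refine Finset.card_lt_card ⟨fun s hs => ?_, fun hsub => ?_⟩
    · obtain rfl | hne := eq_or_ne s t
      · simp at hs
      · simpa [Function.update_of_ne hne] using hs
    · have : t ∈ Finset.univ.filter fun s => f s ≠ Function.update g t (f t) s :=
        hsub (by simp [ht, hft])
      simp at this) hgS (j := f t) (by omega) rfl
  have hik : i ≠ f t := by rintro rfl; omega
  have hupi := DFunLike.congr_fun hup i
  simp only [Finsupp.add_apply, Finsupp.single_eq_of_ne hik] at hupi
  have hij : i ≠ j := by
    rintro rfl
    simp only [Finsupp.single_eq_same] at hupi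
    omega
  rw [Finsupp.single_eq_of_ne hij] at hupi
  refine ⟨i, h, hh, by omega, ?_⟩
  apply add_right_cancel (b := Finsupp.single (f t) 1)
  calc _ = fiberCount h + Finsupp.single (f t) 1 + Finsupp.single j 1 := by abel
    _ = fiberCount (Function.update g t (f t)) + Finsupp.single j 1 + Finsupp.single i 1 := by
      rw [hsum]; abel
    _ = _ := by rw [hup]; abel

/-- Polymatroidal ideals have linear quotients. -/
lemma hasLinearQuotients_of_exchange {K : Type} [Field K] {n d : ℕ} (T : Finset (Fin n →₀ ℕ))
    (hdeg : ∀ u ∈ T, u.degree = d)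
    (hex : ∀ u ∈ T, ∀ v ∈ T, ∀ j, u j < v j → ∃ i, ∃ w ∈ T, v i < u i ∧
      w + Finsupp.single j 1 = v + Finsupp.single i 1) :
    HasLinearQuotients
      (Ideal.span ((fun u => (monomial u 1 : MvPolynomial (Fin n) K)) '' (T : Set _))) := by
  classical
  let T' : Finset (Lex (Fin n →₀ ℕ)) := T.map toLex.toEmbedding
  let e : Fin T'.card ≃o T' := T'.orderIsoOfFin rfl
  let x : Fin T'.card → Fin n →₀ ℕ := fun t => ofLex (e t).1
  have hxT (t) : x t ∈ T := by
    obtain ⟨u, hu, hut⟩ := Finset.mem_map.1 (e t).2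
    have : x t = u := by simp only [x, ← hut]; rfl
    exact this ▸ hu
  have hx_surj {u} (hu : u ∈ T) : ∃ t, x t = u :=
    ⟨e.symm ⟨toLex u, Finset.mem_map.2 ⟨u, hu, rfl⟩⟩, by simp [x]⟩
  have hx_lt {s t} : toLex (x s) < toLex (x t) ↔ s < t := by
    simp [x]
  have hx_inj : Function.Injective x := fun s t h =>
    e.injective (Subtype.ext (ofLex.injective h))
  have himage (s : Set (Fin T'.card)) :
      (fun t => (monomial (x t) 1 : MvPolynomial (Fin n) K)) '' s =
        (fun u => monomial u 1) '' (x '' s) := by rw [Set.image_image]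
  refine ⟨T'.card, fun t => monomial (x t) 1, fun _ => d,
    fun t => isHomogeneous_monomial _ (hdeg _ (hxT t)), fun t => by simp, ?_, fun t ht => ?_,
    fun t => ?_⟩
  · rw [← Set.image_univ, himage, Set.image_univ]
    congr 2
    ext u
    exact ⟨by rintro ⟨t, rfl⟩; exact hxT t, hx_surj⟩
  · rw [himage, mem_ideal_span_monomial_image] at ht
    obtain ⟨_, ⟨s, hs, rfl⟩, hle⟩ := ht (x t) (by simp)
    obtain ⟨c, hc⟩ := le_iff_exists_add.1 hle
    have hd := congrArg Finsupp.degree hc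
    rw [map_add, hdeg _ (hxT t), hdeg _ (hxT s)] at hd
    have : c = 0 := (Finsupp.degree_eq_zero_iff c).1 (by omega)
    exact hs (hx_inj (by rw [hc, this, add_zero]))
  · let J : Ideal (MvPolynomial (Fin n) K) :=
      Ideal.span ((fun t => monomial (x t) 1) '' {s | s < t})
    let V : Set (Fin n) := {i | X i * monomial (x t) 1 ∈ J}
    refine ⟨X '' V, by rintro _ ⟨i, -, rfl⟩; exact isHomogeneous_X _ _, ?_⟩
    rw [Ideal.span, Ideal.span, Submodule.colon_span]
    apply le_antisymm
    · intro p hp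
      rw [Submodule.mem_colon_singleton, smul_eq_mul] at hp
      replace hp := himage _ ▸ hp
      refine mem_ideal_span_X_image.2 fun a ha => ?_
      obtain ⟨_, ⟨s, hs, rfl⟩, hle⟩ := mem_ideal_span_monomial_image.1 hp (a + x t) (by
        rwa [mem_support_iff, coeff_mul_monomial, mul_one, ← mem_support_iff])
      obtain ⟨j, hjlt, hj⟩ := Finsupp.Lex.lt_iff.1 (hx_lt.2 hs)
      obtain ⟨i, w, hw, hi, hsum⟩ := hex _ (hxT s) _ (hxT t) j hj
      obtain ⟨r, rfl⟩ := hx_surj hw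
      have hlei := hle i
      rw [Finsupp.add_apply] at hlei
      refine ⟨i, ?_, by omega⟩
      have hrt : r < t := by
        refine hx_lt.1 (Finsupp.Lex.lt_iff.2 ⟨j, fun k hk => ?_, ?_⟩)
        · have hki : k ≠ i := by
            rintro rfl
            exact hi.ne' (hjlt _ hk)
          simpa [hk.ne, hki] using DFunLike.congr_fun hsum k
        · have hji : j ≠ i := by
            rintro rfl
            exact hi.not_gt hj
          have := DFunLike.congr_fun hsum j
          simp only [Finsupp.add_apply, Finsupp.single_eq_same,
            Finsupp.single_eq_of_ne hji] at this
          change x r j < x t j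
          omega
      change X i * monomial (x t) 1 ∈ J
      have : (X i * monomial (x t) 1 : MvPolynomial (Fin n) K) = X j * monomial (x r) 1 := by
        rw [X, X, monomial_mul, monomial_mul, add_comm, ← hsum, add_comm]
      rw [this]
      exact J.mul_mem_left _ (Ideal.subset_span ⟨r, hrt, rfl⟩)
    · refine Submodule.span_le.2 ?_
      rintro _ ⟨i, hi, rfl⟩
      exact Submodule.mem_colon_singleton.2 hi

/-- **Corollary 5.4**: a product `I_1 ⋯ I_d` of ideals, each generated by a subset of
the variables, has linear quotients. -/
theorem statement_16 (K : Type) [Field K] (n d : ℕ) (S : Fin d → Finset (Fin n)) :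
    HasLinearQuotients
      (∏ i, Ideal.span ((fun j => (X j : MvPolynomial (Fin n) K)) '' (S i))) := by
  classical
  have key := hasLinearQuotients_of_exchange (K := K) (d := d)
    ((Fintype.piFinset S).image fiberCount) (by
      intro u hu
      obtain ⟨f, -, rfl⟩ := Finset.mem_image.1 hu
      simp [fiberCount]) (by
      intro u hu v hv j hj
      obtain ⟨f, hf, rfl⟩ := Finset.mem_image.1 hu
      obtain ⟨g, hg, rfl⟩ := Finset.mem_image.1 hv
      obtain ⟨i, h, hh, hi, hsum⟩ := exists_fiberCount_exchange S
        (Fintype.mem_piFinset.1 hf) (Fintype.mem_piFinset.1 hg) hj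
      exact ⟨i, _, Finset.mem_image_of_mem _ (Fintype.mem_piFinset.2 hh), hi, hsum⟩)
  convert key using 1
  rw [Ideal.prod_span]
  congr 1
  have hmon (f : Fin d → Fin n) :
      (monomial (fiberCount f) 1 : MvPolynomial (Fin n) K) = ∏ t, X (f t) := by
    simp [fiberCount, X, monomial_sum_one]
  ext p
  rw [Set.mem_fintype_prod]
  constructor
  · rintro ⟨q, hq, rfl⟩
    choose f hf hfq using hq
    exact ⟨fiberCount f, Finset.mem_coe.2 (Finset.mem_image_of_mem _ (Fintype.mem_piFinset.2 hf)),
      by simp only [hmon, ← hfq]⟩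
  · rintro ⟨u, hu, rfl⟩
    obtain ⟨f, hf, rfl⟩ := Finset.mem_image.1 hu
    exact ⟨fun t => X (f t), fun t => ⟨f t, Fintype.mem_piFinset.1 hf t, rfl⟩, (hmon f).symm⟩
end

section
/- Let I and J be matroidal ideals in K[x_1,…,x_n], and let I * J be the squarefree product of I and J, namely the ideal generated by all squarefree monomials uv with u ∈ G(I) and v ∈ G(J). Then I * J is matroidal. -/
open MvPolynomial

/-- The monomial ideal with monomial generators the members of `G`. -/
noncomputable def monSpan (K : Type) [Field K] {n : ℕ} (G : Set (Fin n →₀ ℕ)) :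
    Ideal (MvPolynomial (Fin n) K) :=
  Ideal.span ((fun u => monomial u (1 : K)) '' G)

/-- `G` is a minimal monomial generating set of the ideal it generates. -/
def MinimalMonGens (K : Type) [Field K] {n : ℕ} (G : Finset (Fin n →₀ ℕ)) : Prop :=
  ∀ u ∈ G, monomial u (1 : K) ∉ monSpan K ((G : Set (Fin n →₀ ℕ)) \ {u})

/-- The polymatroid exchange property for a set of exponent vectors. -/
def ExchangeProp {n : ℕ} (G : Finset (Fin n →₀ ℕ)) : Prop :=
  ∀ u ∈ G, ∀ v ∈ G, ∀ i : Fin n, v i < u i →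
    ∃ j : Fin n, u j < v j ∧ u - Finsupp.single i 1 + Finsupp.single j 1 ∈ G

/-- A monomial ideal is *matroidal* if it is polymatroidal (minimal monomial
generators all of the same degree satisfying the exchange property) and its minimal
monomial generators are squarefree. -/
def IsMatroidal {K : Type} [Field K] {n : ℕ} (I : Ideal (MvPolynomial (Fin n) K)) : Prop :=
  ∃ (G : Finset (Fin n →₀ ℕ)) (δ : ℕ),
    (∀ u ∈ G, (u.sum fun _ e => e) = δ) ∧
    (∀ u ∈ G, ∀ i : Fin n, u i ≤ 1) ∧
    I = monSpan K (G : Set (Fin n →₀ ℕ)) ∧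
    MinimalMonGens K G ∧
    ExchangeProp G

namespace Matroid

variable {α : Type*} [Finite α]

/-- Augmentation for disjoint unions of independent sets of two matroids. -/
theorem exists_indep_union_insert (M N : Matroid α) {A B C D : Set α}
    (hA : M.Indep A) (hB : N.Indep B) (hC : M.Indep C) (hD : N.Indep D)
    (hAB : Disjoint A B) (hCD : Disjoint C D)
    (hlt : A.ncard + B.ncard < C.ncard + D.ncard) :
    ∃ f ∈ (C ∪ D) \ (A ∪ B), ∃ A' B', M.Indep A' ∧ N.Indep B' ∧ Disjoint A' B' ∧
      A' ∪ B' = insert f (A ∪ B) := by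
  induction hk : (C \ A).ncard + (D \ B).ncard using Nat.strong_induction_on
    generalizing M N A B C D with
  | _ k ih =>
  wlog hlt' : A.ncard < C.ncard generalizing M N A B C D
  · obtain ⟨f, hf, A', B', hA', hB', hdisj, hU⟩ := this N M hB hA hD hC hAB.symm hCD.symm
      (by omega) (by omega) (by omega)
    refine ⟨f, by simpa only [Set.union_comm] using hf, B', A', hB', hA', hdisj.symm, ?_⟩
    rw [Set.union_comm, hU, Set.union_comm B A]
  obtain ⟨f, hf, hfA⟩ := hA.augment hC (by
    rw [← A.toFinite.cast_ncard_eq, ← C.toFinite.cast_ncard_eq]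
    exact_mod_cast hlt')
  by_cases hfB : f ∈ B
  · have hfD : f ∉ D := fun h => hCD.le_bot ⟨hf.1, h⟩
    have hU : insert f A ∪ B \ {f} = A ∪ B := by
      ext x
      by_cases hx : x = f <;> simp [hx, hfB]
    have hDB : D \ (B \ {f}) = D \ B := by
      ext x
      by_cases hx : x = f <;> simp [hx, hfD]
    have hCA : (C \ insert f A).ncard < (C \ A).ncard :=
      Set.ncard_lt_ncard ⟨fun x hx => ⟨hx.1, fun h => hx.2 (Or.inr h)⟩,
        fun h => (h hf).2 (Or.inl rfl)⟩
    have hcard₁ := Set.ncard_insert_of_notMem hf.2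
    have hcard₂ := Set.ncard_sdiff_singleton_add_one hfB
    have hdisj : Disjoint (insert f A) (B \ {f}) := by
      rw [Set.disjoint_left] at hAB ⊢
      rintro x (rfl | hx) ⟨hxB, hxf⟩
      · exact hxf rfl
      · exact hAB hx hxB
    have h := ih _ (by rw [hDB, ← hk]; omega) M N hfA (hB.subset Set.sdiff_subset) hC hD
      hdisj hCD (by omega) rfl
    rwa [hU] at h
  · refine ⟨f, ⟨Or.inl hf.1, fun h => h.elim hf.2 hfB⟩, insert f A, B, hfA, hB, ?_,
      Set.insert_union⟩
    exact Set.disjoint_insert_left.2 ⟨hfB, hAB⟩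

/-- Base exchange for disjoint unions of bases of two matroids. -/
theorem exists_isBase_union_exchange (M N : Matroid α) {A B C D : Set α}
    (hA : M.IsBase A) (hB : N.IsBase B) (hC : M.IsBase C) (hD : N.IsBase D)
    (hAB : Disjoint A B) (hCD : Disjoint C D) {e : α} (he : e ∈ (A ∪ B) \ (C ∪ D)) :
    ∃ f ∈ (C ∪ D) \ (A ∪ B), ∃ A' B', M.IsBase A' ∧ N.IsBase B' ∧ Disjoint A' B' ∧
      A' ∪ B' = insert f ((A ∪ B) \ {e}) := by
  have hsplit : A \ {e} ∪ B \ {e} = (A ∪ B) \ {e} := (Set.union_sdiff_distrib ..).symm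
  have hdisj : Disjoint (A \ {e}) (B \ {e}) := hAB.mono Set.sdiff_subset Set.sdiff_subset
  have hAC := hA.ncard_eq_ncard_of_isBase hC
  have hBD := hB.ncard_eq_ncard_of_isBase hD
  have hcard : (A \ {e}).ncard + (B \ {e}).ncard + 1 = A.ncard + B.ncard := by
    rw [← Set.ncard_union_eq hdisj, hsplit, Set.ncard_sdiff_singleton_add_one he.1,
      Set.ncard_union_eq hAB]
  obtain ⟨f, hf, A', B', hA', hB', hdisj', hU⟩ := M.exists_indep_union_insert N
    (hA.indep.subset Set.sdiff_subset) (hB.indep.subset Set.sdiff_subset)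
    hC.indep hD.indep hdisj hCD (by omega)
  rw [hsplit] at hf hU
  have hfe : f ≠ e := fun h => he.2 (h ▸ hf.1)
  have hcard' : A'.ncard + B'.ncard = A.ncard + B.ncard := by
    rw [← Set.ncard_union_eq hdisj', hU, Set.ncard_insert_of_notMem hf.2,
      Set.ncard_sdiff_singleton_add_one he.1, Set.ncard_union_eq hAB]
  obtain ⟨A₁, hA₁, hle₁⟩ := hA'.exists_isBase_superset
  obtain ⟨B₁, hB₁, hle₂⟩ := hB'.exists_isBase_superset
  have h₁ := hA₁.ncard_eq_ncard_of_isBase hA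
  have h₂ := hB₁.ncard_eq_ncard_of_isBase hB
  have h₃ := Set.ncard_le_ncard hle₁
  have h₄ := Set.ncard_le_ncard hle₂
  obtain rfl := Set.eq_of_subset_of_ncard_le hle₁ (by omega)
  obtain rfl := Set.eq_of_subset_of_ncard_le hle₂ (by omega)
  exact ⟨f, ⟨hf.1, fun h => hf.2 ⟨h, hfe⟩⟩, A', B', hA₁, hB₁, hdisj', hU⟩

end Matroid

/-- A squarefree exponent vector is determined by its support. -/
theorem eq_of_support_eq_of_le_one {n : ℕ} {u v : Fin n →₀ ℕ} (hu : ∀ i, u i ≤ 1)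
    (hv : ∀ i, v i ≤ 1) (h : Function.support u = Function.support v) : u = v := by
  ext i
  have hi : u i ≠ 0 ↔ v i ≠ 0 := Set.ext_iff.1 h i
  have := hu i
  have := hv i
  omega

/-- The supports of a nonempty squarefree family with the exchange property are the bases of a
matroid. -/
theorem ExchangeProp.exists_matroid {n : ℕ} {G : Finset (Fin n →₀ ℕ)} (hex : ExchangeProp G)
    (hsq : ∀ u ∈ G, ∀ i, u i ≤ 1) (hne : G.Nonempty) :
    ∃ M : Matroid (Fin n), ∀ S, M.IsBase S ↔ ∃ u ∈ G, Function.support u = S := by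
  refine ⟨Matroid.ofIsBaseOfFinite (E := Set.univ) Set.finite_univ
    (fun S => ∃ u ∈ G, Function.support u = S) ?_ ?_ fun _ _ => Set.subset_univ _,
    fun S => by rw [Matroid.ofIsBaseOfFinite_isBase]⟩
  · obtain ⟨u, hu⟩ := hne
    exact ⟨_, u, hu, rfl⟩
  · rintro _ _ ⟨u, hu, rfl⟩ ⟨v, hv, rfl⟩ i ⟨hi, hi'⟩
    rw [Function.mem_support] at hi hi'
    obtain ⟨j, hj, hmem⟩ := hex u hu v hv i (by omega)
    have hvj := hsq v hv j
    have hui := hsq u hu i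
    refine ⟨j, ⟨?_, ?_⟩, _, hmem, ?_⟩
    · rw [Function.mem_support]; omega
    · rw [Function.mem_support]; omega
    · ext k
      by_cases hkj : k = j <;> by_cases hki : k = i <;>
        simp [hkj, hki, Finsupp.single_apply]
      all_goals grind

/-- A monomial family all of whose members have the same degree is a minimal generating set. -/
theorem minimalMonGens_of_sum_eq (K : Type) [Field K] {n : ℕ} {G : Finset (Fin n →₀ ℕ)} {δ : ℕ}
    (hdeg : ∀ u ∈ G, (u.sum fun _ e => e) = δ) : MinimalMonGens K G := by
  intro u hu hmem
  obtain ⟨v, ⟨hv, hvu⟩, hle⟩ := mem_ideal_span_monomial_image.1 hmem u (by simp)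
  refine hvu (Finsupp.ext fun i => ?_)
  have hsum := (hdeg v hv).trans (hdeg u hu).symm
  rw [Finsupp.sum_fintype _ _ fun _ => rfl, Finsupp.sum_fintype _ _ fun _ => rfl] at hsum
  exact (Finset.sum_eq_sum_iff_of_le fun i _ => hle i).1 hsum i (Finset.mem_univ i)

/-- The squarefree products of members of two squarefree families with the exchange property
again have the exchange property. -/
theorem ExchangeProp.squarefree_add {n : ℕ} {GI GJ G : Finset (Fin n →₀ ℕ)}
    (hexI : ExchangeProp GI) (hexJ : ExchangeProp GJ)
    (hsqI : ∀ u ∈ GI, ∀ i, u i ≤ 1) (hsqJ : ∀ v ∈ GJ, ∀ i, v i ≤ 1)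
    (hG : ∀ w, w ∈ G ↔ ∃ u ∈ GI, ∃ v ∈ GJ, w = u + v ∧ ∀ i, (u + v) i ≤ 1) :
    ExchangeProp G := by
  have hdisj : ∀ u v : Fin n →₀ ℕ, (∀ i, (u + v) i ≤ 1) →
      Disjoint (Function.support u) (Function.support v) := by
    intro u v h
    rw [Set.disjoint_left]
    intro i hu hv
    have := h i
    rw [Finsupp.add_apply] at this
    rw [Function.mem_support] at hu hv
    omega
  have hsupp : ∀ u v : Fin n →₀ ℕ,
      Function.support u ∪ Function.support v = Function.support (u + v) := by
    intro u v
    ext i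
    simp [or_iff_not_imp_left]
  intro w hw w' hw' i hi
  obtain ⟨u, hu, v, hv, rfl, huv⟩ := (hG w).1 hw
  obtain ⟨u', hu', v', hv', rfl, huv'⟩ := (hG w').1 hw'
  obtain ⟨M, hM⟩ := hexI.exists_matroid hsqI ⟨u, hu⟩
  obtain ⟨N, hN⟩ := hexJ.exists_matroid hsqJ ⟨v, hv⟩
  have huvi := huv i
  obtain ⟨j, hj, A, B, hA, hB, hAB, hU⟩ := M.exists_isBase_union_exchange N
    ((hM _).2 ⟨u, hu, rfl⟩) ((hN _).2 ⟨v, hv, rfl⟩) ((hM _).2 ⟨u', hu', rfl⟩)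
    ((hN _).2 ⟨v', hv', rfl⟩) (hdisj u v huv) (hdisj u' v' huv') (e := i) (by
      rw [hsupp, hsupp, Set.mem_sdiff,
        Function.mem_support, Function.mem_support]
      omega)
  rw [hsupp, hsupp, Set.mem_sdiff,
    Function.mem_support, Function.mem_support, not_not] at hj
  obtain ⟨a, ha, rfl⟩ := (hM A).1 hA
  obtain ⟨b, hb, rfl⟩ := (hN B).1 hB
  rw [hsupp, hsupp] at hU
  have hab : ∀ k, (a + b) k ≤ 1 := by
    intro k
    have h₁ := hsqI a ha k
    have h₂ := hsqJ b hb k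
    have h₃ : k ∈ Function.support a → k ∉ Function.support b :=
      fun h => Set.disjoint_left.1 hAB h
    rw [Function.mem_support, Function.mem_support] at h₃
    rw [Finsupp.add_apply]
    omega
  refine ⟨j, by omega, (hG _).2 ⟨a, ha, b, hb, ?_, hab⟩⟩
  generalize u + v = w at *
  have hji : j ≠ i := by rintro rfl; omega
  refine eq_of_support_eq_of_le_one (fun k => ?_) hab ?_
  · have := huv k
    by_cases hkj : k = j
    · simp [hkj, hj.2]
    · simp [Finsupp.single_apply, Ne.symm hkj]
      omega
  · rw [hU]
    ext k
    by_cases hkj : k = j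
    · simp [hkj]
    · by_cases hki : k = i
      · subst hki
        simp [hji]
        omega
      · simp [hkj, hki]

/-- **Theorem 5.5**: if `I` and `J` are matroidal ideals, with minimal monomial
generators `G(I)` and `G(J)`, then the squarefree product `I * J`, generated by all
squarefree monomials `uv` with `u ∈ G(I)` and `v ∈ G(J)`, is matroidal. -/
theorem statement_17 (K : Type) [Field K] (n : ℕ)
    (I J : Ideal (MvPolynomial (Fin n) K))
    (GI GJ : Finset (Fin n →₀ ℕ)) (δI δJ : ℕ)
    (hdegI : ∀ u ∈ GI, (u.sum fun _ e => e) = δI)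
    (hdegJ : ∀ v ∈ GJ, (v.sum fun _ e => e) = δJ)
    (hsqI : ∀ u ∈ GI, ∀ i : Fin n, u i ≤ 1)
    (hsqJ : ∀ v ∈ GJ, ∀ i : Fin n, v i ≤ 1)
    (hgenI : I = monSpan K (GI : Set (Fin n →₀ ℕ)))
    (hgenJ : J = monSpan K (GJ : Set (Fin n →₀ ℕ)))
    (hminI : MinimalMonGens K GI) (hminJ : MinimalMonGens K GJ)
    (hexI : ExchangeProp GI) (hexJ : ExchangeProp GJ) :
    IsMatroidal (monSpan K
      {w : Fin n →₀ ℕ | ∃ u ∈ GI, ∃ v ∈ GJ, w = u + v ∧ ∀ i : Fin n, (u + v) i ≤ 1}) := by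
  classical
  set G : Finset (Fin n →₀ ℕ) :=
    ((GI ×ˢ GJ).image fun p => p.1 + p.2).filter fun w => ∀ i, w i ≤ 1
  have hG : ∀ w, w ∈ G ↔ ∃ u ∈ GI, ∃ v ∈ GJ, w = u + v ∧ ∀ i, (u + v) i ≤ 1 := by
    intro w
    simp only [G, Finset.mem_filter, Finset.mem_image, Finset.mem_product, Prod.exists]
    constructor
    · rintro ⟨⟨u, v, ⟨hu, hv⟩, rfl⟩, h⟩
      exact ⟨u, hu, v, hv, rfl, h⟩
    · rintro ⟨u, hu, v, hv, rfl, h⟩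
      exact ⟨⟨u, v, ⟨hu, hv⟩, rfl⟩, h⟩
  have hdeg : ∀ w ∈ G, (w.sum fun _ e => e) = δI + δJ := by
    intro w hw
    obtain ⟨u, hu, v, hv, rfl, -⟩ := (hG w).1 hw
    rw [Finsupp.sum_add_index' (fun _ => rfl) fun _ _ _ => rfl, hdegI u hu, hdegJ v hv]
  refine ⟨G, δI + δJ, hdeg, fun w hw => (Finset.mem_filter.1 hw).2, ?_,
    minimalMonGens_of_sum_eq K hdeg, hexI.squarefree_add hexJ hsqI hsqJ hG⟩
  congr 1
  ext w
  exact (hG w).symm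
end
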